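/- Let r := min{rank A, rank B}. The supremum over all nonzero real m×m matrices Z with φ_{C_qm}(Z) > 0 of the ratio φ_{C_max}(Z)/φ_{C_qm}(Z) is attained and equals 3 if r = 3, and equals 1 if r ≤ 2. In particular, if r ≤ 2 then C_max = C_qm. -/

import Mathlib

open Matrix Kronecker
open scoped ENNReal ComplexOrder

namespace BellCorr

/-- The three Pauli matrices. -/
noncomputable def pauli (k : Fin 3) : Matrix (Fin 2) (Fin 2) ℂ :=
  if k = 0 then !![0, 1; 1, 0]
  else if k = 1 then !![0, -Complex.I; Complex.I, 0]
  else !![1, 0; 0, -1]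

/-- The observable `Â_i = ∑ k A i k • σ_k` associated with row `i` of `A`. -/
noncomputable def obs {m : ℕ} (A : Matrix (Fin m) (Fin 3) ℝ) (i : Fin m) :
    Matrix (Fin 2) (Fin 2) ℂ :=
  ∑ k : Fin 3, (A i k : ℂ) • pauli k

/-- The correlation map `Φ_AB`, sending a 4×4 complex matrix to the real m×m matrix
with entries `Tr[ρ (Â_i ⊗ B̂_j)]`. -/
noncomputable def corr {m : ℕ} (A B : Matrix (Fin m) (Fin 3) ℝ)
    (ρ : Matrix (Fin 2 × Fin 2) (Fin 2 × Fin 2) ℂ) : Matrix (Fin m) (Fin m) ℝ :=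
  Matrix.of fun i j => ((ρ * (obs A i ⊗ₖ obs B j)).trace).re

/-- Separable states: convex hull of products of 2×2 PSD trace-one matrices. -/
noncomputable def Ssep : Set (Matrix (Fin 2 × Fin 2) (Fin 2 × Fin 2) ℂ) :=
  convexHull ℝ {ρ | ∃ ρA ρB : Matrix (Fin 2) (Fin 2) ℂ,
    ρA.PosSemidef ∧ ρA.trace = 1 ∧ ρB.PosSemidef ∧ ρB.trace = 1 ∧ ρ = ρA ⊗ₖ ρB}

/-- Quantum states: 4×4 PSD matrices of trace one. -/
def Sqm : Set (Matrix (Fin 2 × Fin 2) (Fin 2 × Fin 2) ℂ) :=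
  {ρ | ρ.PosSemidef ∧ ρ.trace = 1}

/-- Maximal-tensor-product states: self-adjoint trace-one matrices pairing
nonnegatively with every product of PSD matrices. -/
def Smax : Set (Matrix (Fin 2 × Fin 2) (Fin 2 × Fin 2) ℂ) :=
  {ρ | ρ.IsHermitian ∧ ρ.trace = 1 ∧
    ∀ P Q : Matrix (Fin 2) (Fin 2) ℂ, P.PosSemidef → Q.PosSemidef →
      0 ≤ ((ρ * (P ⊗ₖ Q)).trace).re}

noncomputable def Csep {m : ℕ} (A B : Matrix (Fin m) (Fin 3) ℝ) :
    Set (Matrix (Fin m) (Fin m) ℝ) := corr A B '' Ssep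

noncomputable def Cqm {m : ℕ} (A B : Matrix (Fin m) (Fin 3) ℝ) :
    Set (Matrix (Fin m) (Fin m) ℝ) := corr A B '' Sqm

noncomputable def Cmax {m : ℕ} (A B : Matrix (Fin m) (Fin 3) ℝ) :
    Set (Matrix (Fin m) (Fin m) ℝ) := corr A B '' Smax

/-- Support function `φ_K(Z) = sup_{C ∈ K} Tr[Zᵀ C]`. -/
noncomputable def suppFn {m : ℕ} (K : Set (Matrix (Fin m) (Fin m) ℝ))
    (Z : Matrix (Fin m) (Fin m) ℝ) : ℝ :=
  sSup ((fun C => (Zᵀ * C).trace) '' K)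

/-- Gauge function `γ_K(C) = inf {t > 0 : C/t ∈ K}`, with value `+∞` if no such `t` exists. -/
noncomputable def gaugeFn {m : ℕ} (K : Set (Matrix (Fin m) (Fin m) ℝ))
    (C : Matrix (Fin m) (Fin m) ℝ) : ℝ≥0∞ :=
  ⨅ (t : ℝ) (_ : 0 < t ∧ t⁻¹ • C ∈ K), ENNReal.ofReal t

/-- `XᵀX` is Hermitian for a real matrix `X`. -/
lemma isHermitian_tr_mul_self (X : Matrix (Fin 3) (Fin 3) ℝ) : (Xᵀ * X).IsHermitian := by
  simpa [Matrix.conjTranspose_eq_transpose_of_trivial] using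
    Matrix.isHermitian_conjTranspose_mul_self X

/-- The singular values of a real 3×3 matrix, in decreasing order:
`sval X 0 ≥ sval X 1 ≥ sval X 2 ≥ 0` are the square roots of the eigenvalues of `XᵀX`. -/
noncomputable def sval (X : Matrix (Fin 3) (Fin 3) ℝ) (i : Fin 3) : ℝ :=
  Real.sqrt ((isHermitian_tr_mul_self X).eigenvalues
    (Tuple.sort (isHermitian_tr_mul_self X).eigenvalues i.rev))

/-- Column space of a real matrix. -/
noncomputable def colSpace {m n : ℕ} (X : Matrix (Fin m) (Fin n) ℝ) :
    Submodule ℝ (Fin m → ℝ) := LinearMap.range X.mulVecLin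

/-- `Y` is the Moore–Penrose pseudoinverse of `X`. -/
def IsMP {m n : ℕ} (X : Matrix (Fin m) (Fin n) ℝ) (Y : Matrix (Fin n) (Fin m) ℝ) : Prop :=
  X * Y * X = X ∧ Y * X * Y = Y ∧ (X * Y)ᵀ = X * Y ∧ (Y * X)ᵀ = Y * X

/-- The Pauli vector `∑ k, v k • σ_k` of a real vector `v`. -/
noncomputable def pauliVec (v : Fin 3 → ℝ) : Matrix (Fin 2) (Fin 2) ℂ :=
  ∑ k : Fin 3, (v k : ℂ) • pauli k

lemma pauliVec_eq (v : Fin 3 → ℝ) :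
    pauliVec v = !![(v 2 : ℂ), v 0 - v 1 * Complex.I; v 0 + v 1 * Complex.I, -v 2] := by
  ext i j
  fin_cases i <;> fin_cases j <;>
    simp [pauliVec, pauli, Fin.sum_univ_three, Matrix.add_apply]
  ring

lemma pauliVec_isHermitian (v : Fin 3 → ℝ) : (pauliVec v).IsHermitian := by
  rw [Matrix.IsHermitian, pauliVec_eq]
  ext i j
  fin_cases i <;> fin_cases j <;> simp [Complex.ext_iff]

lemma pauliVec_mul (u v : Fin 3 → ℝ) :
    pauliVec u * pauliVec v =
      ((u ⬝ᵥ v : ℝ) : ℂ) • (1 : Matrix (Fin 2) (Fin 2) ℂ) +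
        Complex.I • pauliVec (crossProduct u v) := by
  simp only [pauliVec_eq]
  ext i j
  fin_cases i <;> fin_cases j <;>
    simp [Matrix.mul_apply, cross_apply, dotProduct, Fin.sum_univ_three, Complex.ext_iff] <;>
    (try constructor) <;> ring

lemma trace_pauliVec (v : Fin 3 → ℝ) : (pauliVec v).trace = 0 := by
  simp [pauliVec_eq, Matrix.trace_fin_two]

lemma trace_pauliVec_mul (u v : Fin 3 → ℝ) :
    (pauliVec u * pauliVec v).trace = 2 * ((u ⬝ᵥ v : ℝ) : ℂ) := by
  simp [pauliVec_mul, trace_pauliVec, mul_comm]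

lemma pauliVec_smul (c : ℝ) (v : Fin 3 → ℝ) : pauliVec (c • v) = (c : ℂ) • pauliVec v := by
  simp [pauliVec, Finset.smul_sum, mul_smul]

lemma pauliVec_neg (v : Fin 3 → ℝ) : pauliVec (-v) = -pauliVec v := by
  simpa using pauliVec_smul (-1) v

lemma pauliVec_sum_smul (v : Fin 3 → ℝ) :
    pauliVec v = ∑ k, (v k : ℂ) • pauliVec (Pi.single k 1) := by
  conv_lhs => rw [pauliVec]
  refine Finset.sum_congr rfl fun k _ => ?_
  simp [pauliVec, Pi.single_apply]

/-- A Hermitian matrix with square `c • 1`, `c ≤ 1`, differs from `-1` by a positive one. -/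
lemma posSemidef_one_add {n : Type*} [Fintype n] [DecidableEq n] {X : Matrix n n ℂ} {c : ℝ}
    (hX : X.IsHermitian) (hc : c ≤ 1) (hXX : X * X = (c : ℂ) • 1) : (1 + X).PosSemidef := by
  have h : 1 + X = (2⁻¹ : ℂ) • ((1 + X)ᴴ * (1 + X)) + (((1 - c) / 2 : ℝ) : ℂ) • 1 := by
    have : (1 + X)ᴴ = 1 + X := by simp [hX.eq]
    rw [this, mul_add, add_mul, add_mul, hXX]
    simp only [mul_one, one_mul]
    push_cast
    module
  rw [h]
  refine ((posSemidef_conjTranspose_mul_self _).smul ?_).add (PosSemidef.one.smul ?_)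
  · exact inv_nonneg.2 zero_le_two
  · exact_mod_cast (by linarith : (0 : ℝ) ≤ (1 - c) / 2)

/-- The product of two commuting matrices of the form considered in `posSemidef_one_add`. -/
lemma posSemidef_one_add_mul_one_add {n : Type*} [Fintype n] [DecidableEq n]
    {X Y : Matrix n n ℂ} {c d : ℝ} (hX : X.IsHermitian) (hY : Y.IsHermitian) (hc : c ≤ 1)
    (hd : d ≤ 1) (hXX : X * X = (c : ℂ) • 1) (hYY : Y * Y = (d : ℂ) • 1) (hXY : X * Y = Y * X) :
    (1 + X + Y + X * Y).PosSemidef := by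
  have hP := posSemidef_one_add hX hc hXX
  have hQ := posSemidef_one_add hY hd hYY
  have hcomm : Commute (1 + X) (1 + Y) :=
    ((Commute.one_left _).add_left ((Commute.one_right X).add_right hXY))
  have h : 1 + X + Y + X * Y = (1 + X) * (1 + Y) := by noncomm_ring
  rw [h]
  open scoped MatrixOrder in
  exact (hcomm.mul_nonneg hP.nonneg hQ.nonneg).posSemidef

lemma isHermitian_pauliVec_kronecker (u v : Fin 3 → ℝ) :
    (pauliVec u ⊗ₖ pauliVec v).IsHermitian := by
  rw [Matrix.IsHermitian, conjTranspose_kronecker, (pauliVec_isHermitian u).eq,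
    (pauliVec_isHermitian v).eq]

lemma pauliVec_mul_self (u : Fin 3 → ℝ) :
    pauliVec u * pauliVec u = ((u ⬝ᵥ u : ℝ) : ℂ) • 1 := by
  rw [pauliVec_mul, cross_self]
  simp [pauliVec]

lemma posSemidef_one_add_pauliVec {u : Fin 3 → ℝ} (hu : u ⬝ᵥ u ≤ 1) :
    (1 + pauliVec u).PosSemidef :=
  posSemidef_one_add (pauliVec_isHermitian u) hu (pauliVec_mul_self u)

lemma pauliVec_kronecker_mul_self (u v : Fin 3 → ℝ) :
    (pauliVec u ⊗ₖ pauliVec v) * (pauliVec u ⊗ₖ pauliVec v) =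
      (((u ⬝ᵥ u) * (v ⬝ᵥ v) : ℝ) : ℂ) • 1 := by
  rw [← mul_kronecker_mul, pauliVec_mul_self, pauliVec_mul_self, smul_kronecker, kronecker_smul,
    one_kronecker_one, smul_smul]
  push_cast
  rfl

lemma pauliVec_kronecker_mul {u₁ u₂ v₁ v₂ : Fin 3 → ℝ} (hu : u₁ ⬝ᵥ u₂ = 0) (hv : v₁ ⬝ᵥ v₂ = 0) :
    (pauliVec u₁ ⊗ₖ pauliVec v₁) * (pauliVec u₂ ⊗ₖ pauliVec v₂) =
      -(pauliVec (crossProduct u₁ u₂) ⊗ₖ pauliVec (crossProduct v₁ v₂)) := by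
  rw [← mul_kronecker_mul, pauliVec_mul, pauliVec_mul, hu, hv]
  simp [smul_kronecker, kronecker_smul, smul_smul]

/-- An explicit family of positive matrices with prescribed correlations. -/
lemma posSemidef_pauli_combination {u₁ u₂ v₁ v₂ : Fin 3 → ℝ} (hu : u₁ ⬝ᵥ u₂ = 0)
    (hv : v₁ ⬝ᵥ v₂ = 0) (h₁ : (u₁ ⬝ᵥ u₁) * (v₁ ⬝ᵥ v₁) ≤ 1) (h₂ : (u₂ ⬝ᵥ u₂) * (v₂ ⬝ᵥ v₂) ≤ 1) :
    (1 + pauliVec u₁ ⊗ₖ pauliVec v₁ + pauliVec u₂ ⊗ₖ pauliVec v₂ -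
      pauliVec (crossProduct u₁ u₂) ⊗ₖ pauliVec (crossProduct v₁ v₂)).PosSemidef := by
  have hXY := pauliVec_kronecker_mul hu hv
  have hYX := pauliVec_kronecker_mul (dotProduct_comm u₁ u₂ ▸ hu) (dotProduct_comm v₁ v₂ ▸ hv)
  rw [← cross_anticomm u₁, ← cross_anticomm v₁, pauliVec_neg, pauliVec_neg] at hYX
  have hneg : ∀ P Q : Matrix (Fin 2) (Fin 2) ℂ, (-P) ⊗ₖ (-Q) = P ⊗ₖ Q := fun P Q => by
    ext; simp [kroneckerMap_apply]
  rw [hneg] at hYX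
  rw [sub_eq_add_neg, ← hXY]
  exact posSemidef_one_add_mul_one_add (isHermitian_pauliVec_kronecker _ _)
    (isHermitian_pauliVec_kronecker _ _) h₁ h₂ (pauliVec_kronecker_mul_self _ _)
    (pauliVec_kronecker_mul_self _ _) (hXY.trans hYX.symm)

/-- The correlation form `(a, b) ↦ Tr[ρ (a·σ ⊗ b·σ)]` of `ρ`. -/
noncomputable def corrForm (ρ : Matrix (Fin 2 × Fin 2) (Fin 2 × Fin 2) ℂ)
    (a b : Fin 3 → ℝ) : ℝ :=
  ((ρ * (pauliVec a ⊗ₖ pauliVec b)).trace).re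

lemma corr_apply {m : ℕ} (A B : Matrix (Fin m) (Fin 3) ℝ)
    (ρ : Matrix (Fin 2 × Fin 2) (Fin 2 × Fin 2) ℂ) (i j : Fin m) :
    corr A B ρ i j = corrForm ρ (A i) (B j) := rfl

/-- The matrix of `corrForm ρ`. -/
noncomputable def corrMatrix (ρ : Matrix (Fin 2 × Fin 2) (Fin 2 × Fin 2) ℂ) :
    Matrix (Fin 3) (Fin 3) ℝ :=
  Matrix.of fun k l => corrForm ρ (Pi.single k 1) (Pi.single l 1)

lemma corrForm_eq (ρ : Matrix (Fin 2 × Fin 2) (Fin 2 × Fin 2) ℂ) (a b : Fin 3 → ℝ) :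
    corrForm ρ a b = a ⬝ᵥ corrMatrix ρ *ᵥ b := by
  have hk : pauliVec a ⊗ₖ pauliVec b =
      ∑ k, ∑ l, ((a k * b l : ℝ) : ℂ) • (pauliVec (Pi.single k 1) ⊗ₖ pauliVec (Pi.single l 1)) := by
    rw [pauliVec_sum_smul a, pauliVec_sum_smul b]
    ext ⟨i, i'⟩ ⟨j, j'⟩
    simp only [kroneckerMap_apply, Matrix.sum_apply, Matrix.smul_apply, Finset.sum_mul_sum,
      smul_eq_mul]
    refine Finset.sum_congr rfl fun k _ => Finset.sum_congr rfl fun l _ => ?_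
    push_cast
    ring
  rw [corrForm, hk]
  simp only [Matrix.mul_sum, Matrix.mul_smul, Matrix.trace_sum, Matrix.trace_smul, smul_eq_mul,
    Complex.re_sum, Complex.re_ofReal_mul]
  simp only [dotProduct, mulVec, corrMatrix, Matrix.of_apply, corrForm, Finset.mul_sum]
  exact Finset.sum_congr rfl fun k _ => Finset.sum_congr rfl fun l _ => by ring

lemma re_trace_mul_nonneg {n : Type*} [Fintype n] [DecidableEq n] {P Q : Matrix n n ℂ}
    (hP : P.PosSemidef) (hQ : Q.PosSemidef) : 0 ≤ ((P * Q).trace).re := by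
  open scoped MatrixOrder in
  obtain ⟨C, rfl⟩ := CStarAlgebra.nonneg_iff_eq_star_mul_self.mp hP.nonneg
  rw [star_eq_conjTranspose, mul_assoc, trace_mul_comm]
  exact (Complex.le_def.1 (hQ.mul_mul_conjTranspose_same C).trace_nonneg).1

lemma Sqm_subset_Smax : Sqm ⊆ Smax := fun _ h =>
  ⟨h.1.isHermitian, h.2, fun _ _ hP hQ => re_trace_mul_nonneg h.1 (hP.kronecker hQ)⟩

lemma trace_kron_mul_kron (u v a b : Fin 3 → ℝ) :
    ((pauliVec u ⊗ₖ pauliVec v) * (pauliVec a ⊗ₖ pauliVec b)).trace =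
      ((4 * (a ⬝ᵥ u) * (b ⬝ᵥ v) : ℝ) : ℂ) := by
  rw [← mul_kronecker_mul, trace_kronecker, trace_pauliVec_mul, trace_pauliVec_mul,
    dotProduct_comm u, dotProduct_comm v]
  push_cast
  ring

lemma exists_mem_Sqm_corrForm {u₁ u₂ v₁ v₂ : Fin 3 → ℝ} (hu : u₁ ⬝ᵥ u₂ = 0)
    (hv : v₁ ⬝ᵥ v₂ = 0) (h₁ : (u₁ ⬝ᵥ u₁) * (v₁ ⬝ᵥ v₁) ≤ 1) (h₂ : (u₂ ⬝ᵥ u₂) * (v₂ ⬝ᵥ v₂) ≤ 1) :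
    ∃ ρ ∈ Sqm, ∀ a b, corrForm ρ a b = (a ⬝ᵥ u₁) * (b ⬝ᵥ v₁) + (a ⬝ᵥ u₂) * (b ⬝ᵥ v₂) -
      (a ⬝ᵥ crossProduct u₁ u₂) * (b ⬝ᵥ crossProduct v₁ v₂) := by
  refine ⟨(4⁻¹ : ℂ) • _, ⟨(posSemidef_pauli_combination hu hv h₁ h₂).smul ?_, ?_⟩, fun a b => ?_⟩
  · exact inv_nonneg.2 zero_le_four
  · simp [trace_kronecker, trace_pauliVec]
  · rw [corrForm, smul_mul_assoc, sub_mul, add_mul, add_mul, one_mul]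
    simp only [trace_smul, trace_sub, trace_add, trace_kron_mul_kron]
    rw [trace_kronecker, trace_pauliVec, zero_mul, zero_add, smul_eq_mul]
    rw [show (4⁻¹ : ℂ) = ((4⁻¹ : ℝ) : ℂ) by push_cast; rfl]
    rw [Complex.re_ofReal_mul]
    simp only [Complex.sub_re, Complex.add_re, Complex.ofReal_re]
    ring

lemma corrForm_neg_left (ρ : Matrix (Fin 2 × Fin 2) (Fin 2 × Fin 2) ℂ) (a b : Fin 3 → ℝ) :
    corrForm ρ (-a) b = -corrForm ρ a b := by
  simp [corrForm_eq]

lemma neg_one_le_corrForm {ρ : Matrix (Fin 2 × Fin 2) (Fin 2 × Fin 2) ℂ} (hρ : ρ ∈ Smax)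
    {a b : Fin 3 → ℝ} (ha : a ⬝ᵥ a ≤ 1) (hb : b ⬝ᵥ b ≤ 1) : -1 ≤ corrForm ρ a b := by
  have h₁ := hρ.2.2 _ _ (posSemidef_one_add_pauliVec ha) (posSemidef_one_add_pauliVec hb)
  have h₂ := hρ.2.2 _ _ (posSemidef_one_add_pauliVec (u := -a) (by simpa using ha))
    (posSemidef_one_add_pauliVec (u := -b) (by simpa using hb))
  have hsum : (1 + pauliVec a) ⊗ₖ (1 + pauliVec b) + (1 + pauliVec (-a)) ⊗ₖ (1 + pauliVec (-b)) =
      (2 : ℂ) • (1 + pauliVec a ⊗ₖ pauliVec b) := by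
    rw [← one_kronecker_one, pauliVec_neg, pauliVec_neg]
    ext ⟨i, i'⟩ ⟨j, j'⟩
    simp only [kroneckerMap_apply, Matrix.add_apply, Matrix.smul_apply, Matrix.neg_apply,
      smul_eq_mul]
    ring
  have h := add_nonneg h₁ h₂
  rw [← Complex.add_re, ← trace_add, ← mul_add, hsum, mul_smul_comm, mul_add, mul_one, trace_smul,
    trace_add, hρ.2.1] at h
  have : ((2 : ℂ) • (1 + (ρ * (pauliVec a ⊗ₖ pauliVec b)).trace)).re =
      2 * (1 + corrForm ρ a b) := by simp [corrForm]
  linarith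

lemma abs_corrForm_le_one {ρ : Matrix (Fin 2 × Fin 2) (Fin 2 × Fin 2) ℂ} (hρ : ρ ∈ Smax)
    {a b : Fin 3 → ℝ} (ha : a ⬝ᵥ a ≤ 1) (hb : b ⬝ᵥ b ≤ 1) : |corrForm ρ a b| ≤ 1 := by
  have h := neg_one_le_corrForm hρ (a := -a) (by simpa using ha) hb
  rw [corrForm_neg_left] at h
  exact abs_le.2 ⟨neg_one_le_corrForm hρ ha hb, by linarith⟩

/-- A vector whose inner product with every vector of the unit ball is at most one lies in the
unit ball. -/
lemma dotProduct_self_le_one {t : Fin 3 → ℝ} (h : ∀ b : Fin 3 → ℝ, b ⬝ᵥ b ≤ 1 → b ⬝ᵥ t ≤ 1) :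
    t ⬝ᵥ t ≤ 1 := by
  by_contra! ht
  obtain ⟨s, hs, hpos⟩ : ∃ s : ℝ, s ^ 2 = t ⬝ᵥ t ∧ 1 < s :=
    ⟨√(t ⬝ᵥ t), Real.sq_sqrt (by linarith), by rw [Real.lt_sqrt] <;> linarith⟩
  have hb := h (s⁻¹ • t) (by
    rw [smul_dotProduct, dotProduct_smul, ← hs, smul_eq_mul, smul_eq_mul]
    field_simp
    rfl)
  rw [smul_dotProduct, smul_eq_mul, ← hs] at hb
  have : s⁻¹ * s ^ 2 = s := by field_simp
  linarith

lemma mulVec_dotProduct_self_le_one {ρ : Matrix (Fin 2 × Fin 2) (Fin 2 × Fin 2) ℂ}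
    (hρ : ρ ∈ Smax) {b : Fin 3 → ℝ} (hb : b ⬝ᵥ b ≤ 1) :
    (corrMatrix ρ *ᵥ b) ⬝ᵥ (corrMatrix ρ *ᵥ b) ≤ 1 :=
  dotProduct_self_le_one fun a ha => by
    rw [← corrForm_eq]
    exact (le_abs_self _).trans (abs_corrForm_le_one hρ ha hb)

lemma corrForm_eq_transpose (ρ : Matrix (Fin 2 × Fin 2) (Fin 2 × Fin 2) ℂ) (a b : Fin 3 → ℝ) :
    corrForm ρ a b = b ⬝ᵥ (corrMatrix ρ)ᵀ *ᵥ a := by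
  rw [corrForm_eq, dotProduct_mulVec, mulVec_transpose, dotProduct_comm]

lemma transpose_mulVec_dotProduct_self_le_one
    {ρ : Matrix (Fin 2 × Fin 2) (Fin 2 × Fin 2) ℂ}
    (hρ : ρ ∈ Smax) {a : Fin 3 → ℝ} (ha : a ⬝ᵥ a ≤ 1) :
    ((corrMatrix ρ)ᵀ *ᵥ a) ⬝ᵥ ((corrMatrix ρ)ᵀ *ᵥ a) ≤ 1 :=
  dotProduct_self_le_one fun b hb => by
    rw [← corrForm_eq_transpose]
    exact (le_abs_self _).trans (abs_corrForm_le_one hρ ha hb)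

lemma exists_orthonormal_pair {n : Fin 3 → ℝ} (hn : n ≠ 0) :
    ∃ e f : Fin 3 → ℝ, e ⬝ᵥ e = 1 ∧ f ⬝ᵥ f = 1 ∧ e ⬝ᵥ f = 0 ∧
      ∀ a, n ⬝ᵥ a = 0 → a = (a ⬝ᵥ e) • e + (a ⬝ᵥ f) • f := by
  let N : EuclideanSpace ℝ (Fin 3) := WithLp.toLp 2 n
  have hN : N ≠ 0 := fun h => hn (by simpa [N] using h)
  have : Fact (Module.finrank ℝ (EuclideanSpace ℝ (Fin 3)) = 2 + 1) := ⟨by simp⟩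
  have hfin := Submodule.finrank_orthogonal_span_singleton (𝕜 := ℝ) (n := 2) hN
  let b := (stdOrthonormalBasis ℝ (Submodule.span ℝ {N})ᗮ).reindex (finCongr hfin)
  have hinner : ∀ x y : EuclideanSpace ℝ (Fin 3), inner ℝ x y = x.ofLp ⬝ᵥ y.ofLp := fun x y => by
    simp [EuclideanSpace.inner_eq_star_dotProduct, dotProduct_comm]
  have hb : ∀ i j, (b i : EuclideanSpace ℝ (Fin 3)).ofLp ⬝ᵥ (b j : EuclideanSpace ℝ (Fin 3)).ofLp =
      if i = j then 1 else 0 := fun i j => by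
    rw [← hinner, ← Submodule.coe_inner]
    exact orthonormal_iff_ite.1 b.orthonormal i j
  refine ⟨(b 0 : EuclideanSpace ℝ (Fin 3)).ofLp, (b 1 : EuclideanSpace ℝ (Fin 3)).ofLp,
    by simp [hb], by simp [hb], by simp [hb], fun a ha => ?_⟩
  have hmem : WithLp.toLp 2 a ∈ (Submodule.span ℝ {N})ᗮ := by
    rw [Submodule.mem_orthogonal_singleton_iff_inner_right, hinner]
    exact ha
  have h := b.sum_repr' ⟨_, hmem⟩
  rw [Fin.sum_univ_two] at h
  have h' := congrArg
    (fun x : (Submodule.span ℝ {N})ᗮ => (x : EuclideanSpace ℝ (Fin 3)).ofLp) h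
  simp only [Submodule.coe_inner, hinner, Submodule.coe_add, Submodule.coe_smul, WithLp.ofLp_add,
    WithLp.ofLp_smul] at h'
  rw [dotProduct_comm a, dotProduct_comm a]
  exact h'.symm

/-- An orthonormal basis of the plane orthogonal to `n` whose images under `M` are orthogonal. -/
lemma exists_orthonormal_pair_mulVec (M : Matrix (Fin 3) (Fin 3) ℝ) {n : Fin 3 → ℝ}
    (hn : n ≠ 0) :
    ∃ e f : Fin 3 → ℝ, e ⬝ᵥ e = 1 ∧ f ⬝ᵥ f = 1 ∧ e ⬝ᵥ f = 0 ∧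
      (M *ᵥ e) ⬝ᵥ (M *ᵥ f) = 0 ∧ ∀ a, n ⬝ᵥ a = 0 → a = (a ⬝ᵥ e) • e + (a ⬝ᵥ f) • f := by
  obtain ⟨e, f, he, hf, hef, hspan⟩ := exists_orthonormal_pair hn
  obtain ⟨c, s, hcs, h0⟩ : ∃ c s : ℝ, c ^ 2 + s ^ 2 = 1 ∧
      (M *ᵥ (c • e + s • f)) ⬝ᵥ (M *ᵥ (-s • e + c • f)) = 0 := by
    let g : ℝ → ℝ := fun θ => (M *ᵥ (Real.cos θ • e + Real.sin θ • f)) ⬝ᵥ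
      (M *ᵥ (-Real.sin θ • e + Real.cos θ • f))
    have hg : Continuous g := by
      simp only [g, mulVec_add, mulVec_smul, add_dotProduct, dotProduct_add, smul_dotProduct,
        dotProduct_smul, smul_eq_mul]
      fun_prop
    have hg0 : g 0 = (M *ᵥ e) ⬝ᵥ (M *ᵥ f) := by simp [g]
    have hg1 : g (Real.pi / 2) = -((M *ᵥ e) ⬝ᵥ (M *ᵥ f)) := by
      simp [g, mulVec_neg, dotProduct_comm (M *ᵥ f)]
    have hzero : (0 : ℝ) ∈ Set.uIcc (g 0) (g (Real.pi / 2)) := by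
      rw [hg0, hg1, Set.mem_uIcc]
      rcases le_total 0 ((M *ᵥ e) ⬝ᵥ (M *ᵥ f)) with h | h
      · exact Or.inr ⟨by linarith, h⟩
      · exact Or.inl ⟨h, by linarith⟩
    obtain ⟨θ, -, hθ⟩ := intermediate_value_uIcc hg.continuousOn hzero
    exact ⟨Real.cos θ, Real.sin θ, Real.cos_sq_add_sin_sq θ, hθ⟩
  have hfe : f ⬝ᵥ e = 0 := dotProduct_comm e f ▸ hef
  refine ⟨c • e + s • f, -s • e + c • f, ?_, ?_, ?_, h0, fun a ha => ?_⟩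
  · simp [he, hf, hef, hfe]
    linarith
  · simp [he, hf, hef, hfe]
    linarith
  · simp [he, hf, hef, hfe]
    ring
  · have h := hspan a ha
    simp only [dotProduct_add, dotProduct_smul, smul_eq_mul]
    generalize a ⬝ᵥ e = x at *
    generalize a ⬝ᵥ f = y at *
    rw [h]
    ext i
    simp only [Pi.add_apply, Pi.smul_apply, smul_eq_mul]
    linear_combination -(x * e i + y * f i) * hcs

lemma exists_mem_Sqm_left {ρ : Matrix (Fin 2 × Fin 2) (Fin 2 × Fin 2) ℂ} (hρ : ρ ∈ Smax)
    {n : Fin 3 → ℝ} (hn : n ≠ 0) :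
    ∃ ρ' ∈ Sqm, ∀ a b, n ⬝ᵥ a = 0 → corrForm ρ' a b = corrForm ρ a b := by
  obtain ⟨e, f, he, hf, hef, hM, hspan⟩ := exists_orthonormal_pair_mulVec (corrMatrix ρ)ᵀ hn
  obtain ⟨ρ', hρ', h⟩ := exists_mem_Sqm_corrForm hef hM
    (by rw [he, one_mul]; exact transpose_mulVec_dotProduct_self_le_one hρ he.le)
    (by rw [hf, one_mul]; exact transpose_mulVec_dotProduct_self_le_one hρ hf.le)
  refine ⟨ρ', hρ', fun a b ha => ?_⟩
  have hcross : a ⬝ᵥ crossProduct e f = 0 := by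
    rw [hspan a ha, add_dotProduct, smul_dotProduct, smul_dotProduct, dot_self_cross,
      dot_cross_self]
    simp
  rw [h, hcross, corrForm_eq_transpose]
  conv_rhs => rw [hspan a ha]
  simp [mulVec_add, mulVec_smul]

lemma exists_mem_Sqm_right {ρ : Matrix (Fin 2 × Fin 2) (Fin 2 × Fin 2) ℂ} (hρ : ρ ∈ Smax)
    {n : Fin 3 → ℝ} (hn : n ≠ 0) :
    ∃ ρ' ∈ Sqm, ∀ a b, n ⬝ᵥ b = 0 → corrForm ρ' a b = corrForm ρ a b := by
  obtain ⟨e, f, he, hf, hef, hM, hspan⟩ := exists_orthonormal_pair_mulVec (corrMatrix ρ) hn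
  obtain ⟨ρ', hρ', h⟩ := exists_mem_Sqm_corrForm hM hef
    (by rw [he, mul_one]; exact mulVec_dotProduct_self_le_one hρ he.le)
    (by rw [hf, mul_one]; exact mulVec_dotProduct_self_le_one hρ hf.le)
  refine ⟨ρ', hρ', fun a b hb => ?_⟩
  have hcross : b ⬝ᵥ crossProduct e f = 0 := by
    rw [hspan b hb, add_dotProduct, smul_dotProduct, smul_dotProduct, dot_self_cross,
      dot_cross_self]
    simp
  rw [h, hcross, corrForm_eq]
  conv_rhs => rw [hspan b hb]
  simp [mulVec_add, mulVec_smul, mul_comm]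

lemma exists_ne_zero_dotProduct_eq_zero {m : ℕ} {A : Matrix (Fin m) (Fin 3) ℝ}
    (hA : A.rank ≤ 2) : ∃ n : Fin 3 → ℝ, n ≠ 0 ∧ ∀ i, n ⬝ᵥ A i = 0 := by
  have hker : LinearMap.ker A.mulVecLin ≠ ⊥ := fun h => by
    have := LinearMap.finrank_range_of_inj (LinearMap.ker_eq_bot.1 h)
    rw [Module.finrank_fin_fun] at this
    have : A.rank = 3 := this
    omega
  obtain ⟨n, hn, hn0⟩ := Submodule.exists_mem_ne_zero_of_ne_bot hker
  refine ⟨n, hn0, fun i => ?_⟩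
  rw [dotProduct_comm]
  exact congrFun (show A *ᵥ n = 0 from hn) i

lemma Cqm_subset_Cmax {m : ℕ} (A B : Matrix (Fin m) (Fin 3) ℝ) : Cqm A B ⊆ Cmax A B :=
  Set.image_mono Sqm_subset_Smax

lemma Cmax_eq_Cqm {m : ℕ} {A B : Matrix (Fin m) (Fin 3) ℝ} (h : min A.rank B.rank ≤ 2) :
    Cmax A B = Cqm A B := by
  refine (Set.image_subset_iff.2 fun ρ hρ => ?_).antisymm (Cqm_subset_Cmax A B)
  rcases min_le_iff.1 h with h | h <;> obtain ⟨n, hn, hn'⟩ := exists_ne_zero_dotProduct_eq_zero h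
  · obtain ⟨ρ', hρ', hc⟩ := exists_mem_Sqm_left hρ hn
    exact ⟨ρ', hρ', Matrix.ext fun i j => hc _ _ (hn' i)⟩
  · obtain ⟨ρ', hρ', hc⟩ := exists_mem_Sqm_right hρ hn
    exact ⟨ρ', hρ', Matrix.ext fun i j => hc _ _ (hn' j)⟩

lemma dotProduct_self_row {m : ℕ} {A : Matrix (Fin m) (Fin 3) ℝ} (hA : ∀ i, ∑ k, A i k ^ 2 = 1)
    (i : Fin m) : A i ⬝ᵥ A i = 1 := by
  simpa [dotProduct, sq] using hA i

lemma exists_mem_Sqm_product {u v : Fin 3 → ℝ} (h : (u ⬝ᵥ u) * (v ⬝ᵥ v) ≤ 1) :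
    ∃ ρ ∈ Sqm, ∀ a b, corrForm ρ a b = (a ⬝ᵥ u) * (b ⬝ᵥ v) := by
  obtain ⟨ρ, hρ, hc⟩ := exists_mem_Sqm_corrForm (u₁ := u) (u₂ := 0) (v₁ := v) (v₂ := 0)
    (by simp) (by simp) h (by simp)
  exact ⟨ρ, hρ, fun a b => by simp [hc]⟩

/-- Shrinking the correlations of an element of `Smax` by a factor three makes them quantum. -/
lemma exists_mem_Sqm_three {ρ : Matrix (Fin 2 × Fin 2) (Fin 2 × Fin 2) ℂ} (hρ : ρ ∈ Smax) :
    ∃ ρ' ∈ Sqm, ∀ a b, corrForm ρ a b = 3 * corrForm ρ' a b := by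
  have hk : ∀ k : Fin 3, ∃ τ ∈ Sqm, ∀ a b,
      corrForm τ a b = a k * (b ⬝ᵥ (corrMatrix ρ)ᵀ *ᵥ Pi.single k 1) := fun k => by
    have he : (Pi.single k 1 : Fin 3 → ℝ) ⬝ᵥ Pi.single k 1 = 1 := by simp
    obtain ⟨τ, hτ, hc⟩ := exists_mem_Sqm_product (u := Pi.single k 1)
      (v := (corrMatrix ρ)ᵀ *ᵥ Pi.single k 1)
      (by rw [he, one_mul]; exact transpose_mulVec_dotProduct_self_le_one hρ he.le)
    exact ⟨τ, hτ, fun a b => by simp [hc]⟩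
  choose τ hτ hc using hk
  refine ⟨(3⁻¹ : ℂ) • ∑ k, τ k, ⟨PosSemidef.smul ?_ ?_, ?_⟩, fun a b => ?_⟩
  · exact posSemidef_sum _ fun k _ => (hτ k).1
  · exact inv_nonneg.2 zero_le_three
  · simp [trace_sum, (hτ _).2]
  · have h : corrForm ((3⁻¹ : ℂ) • ∑ k, τ k) a b = 3⁻¹ * ∑ k, corrForm (τ k) a b := by
      rw [corrForm, show (3⁻¹ : ℂ) = ((3⁻¹ : ℝ) : ℂ) by push_cast; rfl, smul_mul_assoc,
        trace_smul, smul_eq_mul, Complex.re_ofReal_mul, Finset.sum_mul, trace_sum,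
        Complex.re_sum]
      rfl
    rw [h, mul_inv_cancel_left₀ three_ne_zero, corrForm_eq_transpose]
    simp only [hc]
    conv_lhs => rw [← Finset.univ_sum_single a]
    simp only [mulVec_sum, dotProduct_sum]
    refine Finset.sum_congr rfl fun k _ => ?_
    rw [show (Pi.single k (a k) : Fin 3 → ℝ) = a k • Pi.single k 1 by simp [← Pi.single_smul],
      mulVec_smul, dotProduct_smul, smul_eq_mul]

lemma bddAbove_Cmax {m : ℕ} {A B : Matrix (Fin m) (Fin 3) ℝ}
    (hA : ∀ i, ∑ k, A i k ^ 2 = 1) (hB : ∀ i, ∑ k, B i k ^ 2 = 1)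
    (Z : Matrix (Fin m) (Fin m) ℝ) :
    BddAbove ((fun C => (Zᵀ * C).trace) '' Cmax A B) := by
  refine ⟨∑ i, ∑ j, |Z j i|, ?_⟩
  rintro _ ⟨_, ⟨ρ, hρ, rfl⟩, rfl⟩
  refine Finset.sum_le_sum fun i _ => ?_
  rw [diag_apply, mul_apply]
  refine Finset.sum_le_sum fun j _ => (le_abs_self _).trans ?_
  rw [abs_mul, transpose_apply, corr_apply]
  exact mul_le_of_le_one_right (abs_nonneg _) (abs_corrForm_le_one hρ
    (dotProduct_self_row hA j).le (dotProduct_self_row hB i).le)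

lemma bddAbove_Cqm {m : ℕ} {A B : Matrix (Fin m) (Fin 3) ℝ}
    (hA : ∀ i, ∑ k, A i k ^ 2 = 1) (hB : ∀ i, ∑ k, B i k ^ 2 = 1)
    (Z : Matrix (Fin m) (Fin m) ℝ) :
    BddAbove ((fun C => (Zᵀ * C).trace) '' Cqm A B) :=
  (bddAbove_Cmax hA hB Z).mono (Set.image_mono (Cqm_subset_Cmax A B))

lemma Cqm_nonempty {m : ℕ} (A B : Matrix (Fin m) (Fin 3) ℝ) : (Cqm A B).Nonempty := by
  obtain ⟨ρ, hρ, -⟩ := exists_mem_Sqm_product (u := 0) (v := 0) (by simp)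
  exact ⟨_, ρ, hρ, rfl⟩

lemma suppFn_Cmax_le {m : ℕ} {A B : Matrix (Fin m) (Fin 3) ℝ}
    (hA : ∀ i, ∑ k, A i k ^ 2 = 1) (hB : ∀ i, ∑ k, B i k ^ 2 = 1)
    (Z : Matrix (Fin m) (Fin m) ℝ) :
    suppFn (Cmax A B) Z ≤ 3 * suppFn (Cqm A B) Z := by
  refine csSup_le (((Cqm_nonempty A B).mono (Cqm_subset_Cmax A B)).image _) ?_
  rintro _ ⟨_, ⟨ρ, hρ, rfl⟩, rfl⟩
  obtain ⟨ρ', hρ', hc⟩ := exists_mem_Sqm_three hρ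
  have h : corr A B ρ = (3 : ℝ) • corr A B ρ' := Matrix.ext fun i j => hc _ _
  simp only [h, Matrix.mul_smul, trace_smul, smul_eq_mul]
  exact mul_le_mul_of_nonneg_left
    (le_csSup (bddAbove_Cqm hA hB Z) ⟨_, ⟨ρ', hρ', rfl⟩, rfl⟩) zero_le_three

lemma exists_suppFn_Cqm_pos {m : ℕ} (hm : 1 ≤ m) {A B : Matrix (Fin m) (Fin 3) ℝ}
    (hA : ∀ i, ∑ k, A i k ^ 2 = 1) (hB : ∀ i, ∑ k, B i k ^ 2 = 1) :
    ∃ Z : Matrix (Fin m) (Fin m) ℝ, Z ≠ 0 ∧ 0 < suppFn (Cqm A B) Z := by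
  let i : Fin m := ⟨0, hm⟩
  have hAi := dotProduct_self_row hA i
  have hBi := dotProduct_self_row hB i
  obtain ⟨ρ, hρ, hc⟩ := exists_mem_Sqm_product (u := A i) (v := B i) (by simp [hAi, hBi])
  refine ⟨Matrix.single i i 1, fun h => ?_, zero_lt_one.trans_le
    (le_csSup (bddAbove_Cqm hA hB _) ⟨_, ⟨ρ, hρ, rfl⟩, ?_⟩)⟩
  · simpa using congrFun (congrFun h i) i
  · simp [Matrix.trace_single_mul, corr_apply, hc, hAi, hBi]

lemma exists_mul_eq_one_of_rank_eq_three {m : ℕ} {A : Matrix (Fin m) (Fin 3) ℝ}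
    (hA : A.rank = 3) : ∃ L : Matrix (Fin 3) (Fin m) ℝ, L * A = 1 := by
  have hker : LinearMap.ker (Matrix.toLin' A) = ⊥ := by
    have h := LinearMap.finrank_range_add_finrank_ker (Matrix.toLin' A)
    rw [Module.finrank_fin_fun] at h
    have h' : Module.finrank ℝ (LinearMap.range (Matrix.toLin' A)) = 3 := hA
    exact Submodule.finrank_eq_zero.1 (by omega)
  obtain ⟨g, hg⟩ := LinearMap.exists_leftInverse_of_injective _ hker
  refine ⟨LinearMap.toMatrix' g, ?_⟩
  have := congrArg LinearMap.toMatrix' hg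
  rwa [LinearMap.toMatrix'_comp, LinearMap.toMatrix'_toLin', LinearMap.toMatrix'_id] at this

lemma corr_eq_mul {m : ℕ} (A B : Matrix (Fin m) (Fin 3) ℝ)
    (ρ : Matrix (Fin 2 × Fin 2) (Fin 2 × Fin 2) ℂ) :
    corr A B ρ = A * corrMatrix ρ * Bᵀ := by
  ext i j
  rw [corr_apply, corrForm_eq, dotProduct_mulVec]
  rfl

lemma trace_mul_kronecker_eq_trace_mul (P Q : Matrix (Fin 2) (Fin 2) ℂ) :
    ((1 + ∑ k, pauliVec (Pi.single k 1) ⊗ₖ pauliVec (Pi.single k 1)) * (P ⊗ₖ Q)).trace =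
      2 * (P * Q).trace := by
  rw [add_mul, one_mul, Finset.sum_mul, trace_add, trace_sum, trace_kronecker]
  simp only [← mul_kronecker_mul, trace_kronecker, pauliVec_eq, Fin.sum_univ_three,
    trace_fin_two, mul_apply, Fin.sum_univ_two]
  simp
  linear_combination (P 0 1 - P 1 0) * (Q 0 1 - Q 1 0) * Complex.I_sq

/-- The partial transpose of a maximally entangled state, whose correlation form is the dot
product. -/
lemma exists_mem_Smax_dotProduct : ∃ ρ ∈ Smax, ∀ a b, corrForm ρ a b = a ⬝ᵥ b := by
  refine ⟨((4⁻¹ : ℝ) : ℂ) • (1 + ∑ k, pauliVec (Pi.single k 1) ⊗ₖ pauliVec (Pi.single k 1)),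
    ⟨?_, ?_, fun P Q hP hQ => ?_⟩, fun a b => ?_⟩
  · simp [Matrix.IsHermitian, (isHermitian_pauliVec_kronecker _ _).eq,
      Fin.sum_univ_three]
  · simp [trace_sum, trace_kronecker, trace_pauliVec]
  · rw [smul_mul_assoc, trace_smul, smul_eq_mul, Complex.re_ofReal_mul,
      trace_mul_kronecker_eq_trace_mul]
    have := re_trace_mul_nonneg hP hQ
    simp
    linarith
  · rw [corrForm, smul_mul_assoc, trace_smul, smul_eq_mul, Complex.re_ofReal_mul,
      trace_mul_kronecker_eq_trace_mul, trace_pauliVec_mul]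
    norm_num
    ring

/-- The singlet state bounds the trace of the correlation matrix of a quantum state. -/
lemma trace_corrMatrix_le_one {ρ : Matrix (Fin 2 × Fin 2) (Fin 2 × Fin 2) ℂ} (hρ : ρ ∈ Sqm) :
    (corrMatrix ρ).trace ≤ 1 := by
  have hneg (a b : Fin 3 → ℝ) : pauliVec a ⊗ₖ pauliVec (-b) = -(pauliVec a ⊗ₖ pauliVec b) := by
    rw [pauliVec_neg]
    ext
    simp [kroneckerMap_apply]
  have hcross : crossProduct (Pi.single 0 1 : Fin 3 → ℝ) (Pi.single 1 1) = Pi.single 2 1 := by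
    ext i
    fin_cases i <;> simp [cross_apply]
  have h := re_trace_mul_nonneg hρ.1 (posSemidef_pauli_combination
    (u₁ := Pi.single 0 1) (u₂ := Pi.single 1 1) (v₁ := -Pi.single 0 1) (v₂ := -Pi.single 1 1)
    (by simp) (by simp) (by simp) (by simp))
  rw [LinearMap.map_neg₂, map_neg, neg_neg, hcross, hneg, hneg, mul_sub, mul_add, mul_add,
    mul_one, mul_neg, mul_neg, trace_sub, trace_add, trace_add, trace_neg, trace_neg, hρ.2] at h
  simp only [Complex.sub_re, Complex.add_re, Complex.neg_re, Complex.one_re] at h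
  simp only [Matrix.trace, diag_apply, Fin.sum_univ_three, corrMatrix, of_apply, corrForm]
  simp only [Matrix.trace, diag_apply] at h
  linarith

/-- A functional that reads off the trace of the correlation matrix attains the ratio three. -/
lemma exists_three_mul_suppFn_le {m : ℕ} {A B : Matrix (Fin m) (Fin 3) ℝ}
    (hA : ∀ i, ∑ k, A i k ^ 2 = 1) (hB : ∀ i, ∑ k, B i k ^ 2 = 1)
    (hrA : A.rank = 3) (hrB : B.rank = 3) :
    ∃ Z : Matrix (Fin m) (Fin m) ℝ, Z ≠ 0 ∧ 0 < suppFn (Cqm A B) Z ∧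
      3 * suppFn (Cqm A B) Z ≤ suppFn (Cmax A B) Z := by
  obtain ⟨L, hL⟩ := exists_mul_eq_one_of_rank_eq_three hrA
  obtain ⟨R, hR⟩ := exists_mul_eq_one_of_rank_eq_three hrB
  have htr (ρ) : ((Lᵀ * R)ᵀ * corr A B ρ).trace = (corrMatrix ρ).trace := by
    rw [corr_eq_mul, transpose_mul, transpose_transpose,
      show Rᵀ * L * (A * corrMatrix ρ * Bᵀ) = Rᵀ * ((L * A) * corrMatrix ρ * Bᵀ) by
        simp only [Matrix.mul_assoc],
      hL, Matrix.one_mul, trace_mul_comm, Matrix.mul_assoc, ← transpose_mul, hR,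
      transpose_one, Matrix.mul_one]
  have hmax : 3 ≤ suppFn (Cmax A B) (Lᵀ * R) := by
    obtain ⟨ρ, hρ, hc⟩ := exists_mem_Smax_dotProduct
    refine le_csSup (bddAbove_Cmax hA hB _) ⟨_, ⟨ρ, hρ, rfl⟩, ?_⟩
    refine (htr ρ).trans ?_
    simp [Matrix.trace, corrMatrix, hc]
  have hqm : suppFn (Cqm A B) (Lᵀ * R) ≤ 1 := by
    refine csSup_le ((Cqm_nonempty A B).image _) ?_
    rintro _ ⟨_, ⟨ρ, hρ, rfl⟩, rfl⟩
    exact (htr ρ).trans_le (trace_corrMatrix_le_one hρ)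
  have hle := suppFn_Cmax_le hA hB (Lᵀ * R)
  refine ⟨Lᵀ * R, fun h => ?_, by linarith, by linarith⟩
  rw [h] at hmax
  have h0 : suppFn (Cmax A B) 0 = 0 := by
    simp [suppFn, ((Cqm_nonempty A B).mono (Cqm_subset_Cmax A B)).image_const]
  linarith

/-- The supremum of `φ_{C_max}/φ_{C_qm}` is attained and equals `3` if
`r = 3` and `1` if `r ≤ 2`; in the latter case `C_max = C_qm`. -/
theorem stmt15 {m : ℕ} (hm : 1 ≤ m) (A B : Matrix (Fin m) (Fin 3) ℝ)
    (hA : ∀ i, ∑ k, A i k ^ 2 = 1) (hB : ∀ i, ∑ k, B i k ^ 2 = 1) :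
    (∀ Z : Matrix (Fin m) (Fin m) ℝ, Z ≠ 0 → 0 < suppFn (Cqm A B) Z →
      suppFn (Cmax A B) Z / suppFn (Cqm A B) Z ≤
        (if min A.rank B.rank = 3 then (3 : ℝ) else 1)) ∧
    (∃ Z : Matrix (Fin m) (Fin m) ℝ, Z ≠ 0 ∧ 0 < suppFn (Cqm A B) Z ∧
      suppFn (Cmax A B) Z / suppFn (Cqm A B) Z =
        (if min A.rank B.rank = 3 then (3 : ℝ) else 1)) ∧
    (min A.rank B.rank ≤ 2 → Cmax A B = Cqm A B) := by
  by_cases hr : min A.rank B.rank = 3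
  · simp only [hr, if_true]
    have hrA : A.rank = 3 := le_antisymm (rank_le_width A) (hr.ge.trans (min_le_left _ _))
    have hrB : B.rank = 3 := le_antisymm (rank_le_width B) (hr.ge.trans (min_le_right _ _))
    refine ⟨fun Z _ hpos => (div_le_iff₀ hpos).2 (suppFn_Cmax_le hA hB Z), ?_, by norm_num⟩
    obtain ⟨Z, hZ, hpos, hle⟩ := exists_three_mul_suppFn_le hA hB hrA hrB
    exact ⟨Z, hZ, hpos, (div_eq_iff hpos.ne').2 ((suppFn_Cmax_le hA hB Z).antisymm hle)⟩
  · have hr₂ : min A.rank B.rank ≤ 2 :=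
      Nat.le_of_lt_succ (lt_of_le_of_ne ((min_le_left _ _).trans (rank_le_width A)) hr)
    have hC := Cmax_eq_Cqm hr₂
    simp only [hr, if_false, hC]
    refine ⟨fun Z _ hpos => (div_self hpos.ne').le, ?_, fun _ => trivial⟩
    obtain ⟨Z, hZ, hpos⟩ := exists_suppFn_Cqm_pos hm hA hB
    exact ⟨Z, hZ, hpos, div_self hpos.ne'⟩

end BellCorr
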